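/- For all integers m, n ≥ 2, there exist a complete DFA A with m states and a complete DFA B with n states over the alphabet {a,b,c,d} such that every complete DFA accepting L(A)*·L(B) has at least 5·2^(m+n−3) − 2^(m−1) − 2^n + 1 states. -/

import Mathlib

open Computability

namespace StarCat

/-- transition function of `A` -/
def fA (k : ℕ) (x : Fin 4) (i : Fin (k + 2)) : Fin (k + 2) :=
  if x = 0 then i + 1 else if x = 1 then (if i = 0 then 0 else i + 1) else i

/-- transition function of `B` -/
def fB (l : ℕ) (x : Fin 4) (i : Fin (l + 2)) : Fin (l + 2) :=
  if x = 2 then i + 1 else if x = 3 then 0 else i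

def dA (k : ℕ) : DFA (Fin 4) (Fin (k + 2)) := ⟨fun i x => fA k x i, 0, {Fin.last (k + 1)}⟩
def dB (l : ℕ) : DFA (Fin 4) (Fin (l + 2)) := ⟨fun i x => fB l x i, 0, {Fin.last (l + 1)}⟩

abbrev St (k l : ℕ) := Finset (Fin (k + 2)) × Finset (Fin (l + 2))

def stp (k l : ℕ) (s : St k l) (x : Fin 4) : St k l :=
  if Fin.last (k + 1) ∈ s.1.image (fA k x) then
    (insert 0 (s.1.image (fA k x)), insert 0 (s.2.image (fB l x)))
  else (s.1.image (fA k x), s.2.image (fB l x))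

def dD (k l : ℕ) : DFA (Fin 4) (St k l) := ⟨stp k l, ({0}, {0}), {s | Fin.last (l + 1) ∈ s.2}⟩

lemma kstar_snoc (k : ℕ) (w : List (Fin 4)) (x : Fin 4) :
    w ++ [x] ∈ (dA k).accepts∗ ↔
      ∃ u v, w = u ++ v ∧ u ∈ (dA k).accepts∗ ∧ fA k x ((dA k).eval v) = Fin.last (k + 1) := by
  constructor
  · intro h
    rw [Language.mem_kstar_iff_exists_nonempty] at h
    obtain ⟨S, hS, hy⟩ := h
    rcases List.eq_nil_or_concat S with rfl | ⟨S', y, rfl⟩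
    · simp at hS
    · have h1 := hy y (by simp)
      rcases List.eq_nil_or_concat y with rfl | ⟨v, z, rfl⟩
      · exact absurd rfl h1.2
      · simp only [List.concat_eq_append, List.flatten_append, List.flatten_cons, List.flatten_nil,
          List.append_nil, ← List.append_assoc] at hS
        have h2 := List.append_inj' hS rfl
        refine ⟨S'.flatten, v, h2.1, ?_, ?_⟩
        · rw [Language.mem_kstar_iff_exists_nonempty]
          exact ⟨S', rfl, fun y hyS => hy y (by simp [hyS])⟩
        · have h3 : x = z := by simpa using h2.2
          subst h3
          have h4 := h1.1
          rw [List.concat_eq_append, DFA.mem_accepts, DFA.eval_append_singleton] at h4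
          exact h4
  · rintro ⟨u, v, rfl, hu, hv⟩
    have h1 : v ++ [x] ∈ (dA k).accepts := by
      rw [DFA.mem_accepts, DFA.eval_append_singleton]; exact hv
    have h2 : (u ++ (v ++ [x])) ∈ (dA k).accepts∗ * (dA k).accepts :=
      Language.append_mem_mul hu h1
    have h3 : (dA k).accepts∗ * (dA k).accepts ≤ (dA k).accepts∗ := kstar_mul_le_kstar
    rw [List.append_assoc]
    exact h3 h2

lemma split_snoc {K : Language (Fin 4)} {τ : Type} (M : DFA (Fin 4) τ) (w : List (Fin 4)) (x : Fin 4)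
    (p : τ) :
    (∃ u v, w ++ [x] = u ++ v ∧ u ∈ K ∧ M.eval v = p) ↔
      ((w ++ [x] ∈ K ∧ M.start = p) ∨ ∃ u v, w = u ++ v ∧ u ∈ K ∧ M.step (M.eval v) x = p) := by
  constructor
  · rintro ⟨u, v, h, hu, hv⟩
    rcases List.eq_nil_or_concat v with rfl | ⟨v', z, rfl⟩
    · left
      rw [List.append_nil] at h
      exact ⟨h ▸ hu, hv⟩
    · right
      rw [List.concat_eq_append, ← List.append_assoc] at h
      have h2 := List.append_inj' h rfl
      have h3 : x = z := by simpa using h2.2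
      subst h3
      rw [List.concat_eq_append, DFA.eval_append_singleton] at hv
      exact ⟨u, v', h2.1, hu, hv⟩
  · rintro (⟨h, h2⟩ | ⟨u, v, rfl, hu, hv⟩)
    · exact ⟨w ++ [x], [], by simp, h, h2⟩
    · exact ⟨u, v ++ [x], by simp, hu, by rw [DFA.eval_append_singleton]; exact hv⟩

lemma eval_char (k l : ℕ) (w : List (Fin 4)) :
    (∀ p, p ∈ ((dD k l).eval w).1 ↔ ∃ u v, w = u ++ v ∧ u ∈ (dA k).accepts∗ ∧ (dA k).eval v = p) ∧
    (∀ p, p ∈ ((dD k l).eval w).2 ↔ ∃ u v, w = u ++ v ∧ u ∈ (dA k).accepts∗ ∧ (dB l).eval v = p) := by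
  induction w using List.reverseRecOn with
  | nil =>
    constructor
    · intro p
      have : p ∈ ((dD k l).eval []).1 ↔ p = 0 := by simp [dD]
      rw [this]
      constructor
      · rintro rfl
        exact ⟨[], [], rfl, Language.nil_mem_kstar _, rfl⟩
      · rintro ⟨u, v, h, _, h2⟩
        have h3 := List.append_eq_nil_iff.1 h.symm
        rw [h3.2] at h2
        exact h2.symm
    · intro p
      have : p ∈ ((dD k l).eval []).2 ↔ p = 0 := by simp [dD]
      rw [this]
      constructor
      · rintro rfl
        exact ⟨[], [], rfl, Language.nil_mem_kstar _, rfl⟩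
      · rintro ⟨u, v, h, _, h2⟩
        have h3 := List.append_eq_nil_iff.1 h.symm
        rw [h3.2] at h2
        exact h2.symm
  | append_singleton w x ih =>
    obtain ⟨ih1, ih2⟩ := ih
    rw [DFA.eval_append_singleton]
    change (∀ p, p ∈ (stp k l ((dD k l).eval w) x).1 ↔ _) ∧
      (∀ p, p ∈ (stp k l ((dD k l).eval w) x).2 ↔ _)
    generalize (dD k l).eval w = s at *
    have hA : ∀ p, p ∈ s.1.image (fA k x) ↔
        ∃ u v, w = u ++ v ∧ u ∈ (dA k).accepts∗ ∧ (dA k).step ((dA k).eval v) x = p := by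
      intro p
      rw [Finset.mem_image]
      constructor
      · rintro ⟨q, hq, rfl⟩
        obtain ⟨u, v, h1, h2, rfl⟩ := (ih1 q).1 hq
        exact ⟨u, v, h1, h2, rfl⟩
      · rintro ⟨u, v, h1, h2, rfl⟩
        exact ⟨_, (ih1 _).2 ⟨u, v, h1, h2, rfl⟩, rfl⟩
    have hB : ∀ p, p ∈ s.2.image (fB l x) ↔
        ∃ u v, w = u ++ v ∧ u ∈ (dA k).accepts∗ ∧ (dB l).step ((dB l).eval v) x = p := by
      intro p
      rw [Finset.mem_image]
      constructor
      · rintro ⟨q, hq, rfl⟩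
        obtain ⟨u, v, h1, h2, rfl⟩ := (ih2 q).1 hq
        exact ⟨u, v, h1, h2, rfl⟩
      · rintro ⟨u, v, h1, h2, rfl⟩
        exact ⟨_, (ih2 _).2 ⟨u, v, h1, h2, rfl⟩, rfl⟩
    have hK : w ++ [x] ∈ (dA k).accepts∗ ↔ Fin.last (k + 1) ∈ s.1.image (fA k x) := by
      rw [kstar_snoc, hA]; rfl
    simp only [split_snoc, ← hA, ← hB, hK]
    have e1 : (dA k).start = 0 := rfl
    have e2 : (dB l).start = 0 := rfl
    rw [e1, e2]
    unfold stp
    split_ifs with h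
    · simp only [h, true_and, Finset.mem_insert]
      exact ⟨fun p => by rw [eq_comm], fun p => by rw [eq_comm]⟩
    · simp [h]

lemma accepts_eq (k l : ℕ) : (dD k l).accepts = (dA k).accepts∗ * (dB l).accepts := by
  ext w
  rw [DFA.mem_accepts, Language.mem_mul]
  change Fin.last (l + 1) ∈ ((dD k l).eval w).2 ↔ _
  rw [(eval_char k l w).2]
  constructor
  · rintro ⟨u, v, rfl, hu, hv⟩
    exact ⟨u, hu, v, hv, rfl⟩
  · rintro ⟨u, hu, v, hv, rfl⟩
    exact ⟨u, v, rfl, hu, hv⟩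

/-! Reachability -/

def Reach (k l : ℕ) (s : St k l) : Prop := ∃ w, (dD k l).eval w = s

variable {k l : ℕ}

lemma Reach.step {s : St k l} (h : Reach k l s) (x : Fin 4) : Reach k l (stp k l s x) := by
  obtain ⟨w, rfl⟩ := h
  exact ⟨w ++ [x], DFA.eval_append_singleton _ _ _⟩

lemma fA0 (i : Fin (k + 2)) : fA k 0 i = i + 1 := by simp [fA]
lemma fA1 (i : Fin (k + 2)) : fA k 1 i = if i = 0 then 0 else i + 1 := by simp [fA]
lemma fA2 (i : Fin (k + 2)) : fA k 2 i = i := by simp [fA]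
lemma fA3 (i : Fin (k + 2)) : fA k 3 i = i := by simp [fA]
lemma fB0 (i : Fin (l + 2)) : fB l 0 i = i := by simp [fB]
lemma fB1 (i : Fin (l + 2)) : fB l 1 i = i := by simp [fB]
lemma fB2 (i : Fin (l + 2)) : fB l 2 i = i + 1 := by simp [fB]
lemma fB3 (i : Fin (l + 2)) : fB l 3 i = 0 := by simp [fB]

lemma imA2 (P : Finset (Fin (k + 2))) : P.image (fA k 2) = P := by
  ext; simp [fA2]
lemma imA3 (P : Finset (Fin (k + 2))) : P.image (fA k 3) = P := by
  ext; simp [fA3]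
lemma imB0 (R : Finset (Fin (l + 2))) : R.image (fB l 0) = R := by
  ext; simp [fB0]
lemma imB1 (R : Finset (Fin (l + 2))) : R.image (fB l 1) = R := by
  ext; simp [fB1]

lemma last_add : Fin.last (k + 1) + 1 = 0 := Fin.last_add_one _

lemma last_ne : Fin.last (k + 1) ≠ 0 := by simp [Fin.ext_iff]

lemma reach_shift {P : Finset (Fin (k + 2))} {R : Finset (Fin (l + 2))} (h : Reach k l (P, R))
    (hP : Fin.last (k + 1) ∉ P) (j : Fin (l + 2)) : Reach k l (P, R.image (· + j)) := by
  induction j using Fin.induction with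
  | zero => simpa using h
  | succ i ih =>
    have := ih.step 2
    simp only [stp, imA2, if_neg hP] at this
    convert this using 2
    ext y
    simp only [Finset.mem_image, exists_exists_and_eq_and, fB2]
    simp only [add_assoc, Fin.coeSucc_eq_succ]

lemma reach_single {R : Finset (Fin (l + 2))} (h : Reach k l ({0}, R)) (i : Fin (k + 1)) :
    Reach k l ({i.castSucc}, R) := by
  induction i using Fin.induction with
  | zero => simpa using h
  | succ i ih =>
    have := ih.step 0
    simp only [stp, imB0, Finset.image_singleton, fA0, Fin.coeSucc_eq_succ] at this
    rw [if_neg] at this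
    · exact this
    · simp only [Finset.mem_singleton, Fin.ext_iff]
      have := i.2
      simp
      omega

lemma reach_ins {R : Finset (Fin (l + 2))} (h : Reach k l ({0}, R)) :
    Reach k l ({0}, insert 0 R) := by
  have h1 := (reach_single h (Fin.last k)).step 0
  simp only [stp, imB0, Finset.image_singleton, fA0, Fin.coeSucc_eq_succ, Fin.succ_last] at h1
  rw [if_pos (by simp)] at h1
  have h2 := h1.step 1
  have e : ({0, Fin.last (k + 1)} : Finset (Fin (k + 2))).image (fA k 1) = {0} := by
    simp [Finset.image_insert, fA1]
  simp only [stp, imB1, e] at h2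
  rw [if_neg (by simp)] at h2
  exact h2

lemma reach_R (R : Finset (Fin (l + 2))) (hR : R.Nonempty) : Reach k l ({0}, R) := by
  have h0 : Fin.last (k + 1) ∉ ({0} : Finset (Fin (k + 2))) := by simp
  induction hR using Finset.Nonempty.cons_induction with
  | singleton r =>
    have : Reach k l ({0}, {0}) := ⟨[], rfl⟩
    simpa using reach_shift this h0 r
  | cons r R hr hR ih =>
    have := reach_shift (reach_ins (reach_shift ih h0 (-r))) h0 r
    convert this using 2
    ext y
    simp

lemma reach_P (R : Finset (Fin (l + 2))) (hR : 0 ∈ R) (N : ℕ) :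
    ∀ P : Finset (Fin (k + 2)), P.card ≤ N → P.Nonempty → (Fin.last (k + 1) ∈ P → 0 ∈ P) →
      Reach k l (P, R) := by
  induction N with
  | zero =>
    intro P h1 h2
    simp [Finset.nonempty_iff_ne_empty] at h1 h2
    exact absurd h1 h2
  | succ N ih =>
    have hl : ∀ P : Finset (Fin (k + 2)), P.card ≤ N + 1 → Fin.last (k + 1) ∈ P → 0 ∈ P →
      Reach k l (P, R) := by
      intro P hc h1 h0
      have hQ : Reach k l ((P.erase 0).image (· - 1), R) := by
        apply ih
        · refine Finset.card_image_le.trans ?_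
          rw [Finset.card_erase_of_mem h0]; omega
        · exact Finset.Nonempty.image ⟨_, Finset.mem_erase.2 ⟨last_ne, h1⟩⟩ _
        · intro h
          obtain ⟨q, hq, h⟩ := Finset.mem_image.1 h
          have : q = 0 := by rw [← last_add (k := k), ← h]; simp
          simp [this] at hq
      have := hQ.step 0
      have e : ((P.erase 0).image (· - 1)).image (fA k 0) = P.erase 0 := by
        ext y; simp [fA0]
      simp only [stp, imB0, e] at this
      rw [if_pos (Finset.mem_erase.2 ⟨last_ne, h1⟩), Finset.insert_erase h0,
        Finset.insert_eq_of_mem hR] at this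
      exact this
    have hn : ∀ j : ℕ, ∀ P : Finset (Fin (k + 2)), P.card ≤ N + 1 → P.Nonempty →
        Fin.last (k + 1) ∉ P → (∀ i ∈ P, i.val ≤ j) → Reach k l (P, R) := by
      intro j
      induction j with
      | zero =>
        intro P hc hne hlP hb
        have : P = {0} := by
          rw [Finset.eq_singleton_iff_nonempty_unique_mem]
          exact ⟨hne, fun x hx => Fin.ext (Nat.le_zero.1 (hb x hx))⟩
        rw [this]
        exact reach_R R ⟨0, hR⟩
      | succ j ihj =>
        intro P hc hne hlP hb
        have eim : (P.image (· - 1)).image (fA k 0) = P := by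
          ext y; simp [fA0]
        have stepa : Reach k l (P.image (· - 1), R) → Reach k l (P, R) := by
          intro h
          have := h.step 0
          simp only [stp, imB0, eim, if_neg hlP] at this
          exact this
        have hval : ∀ q : Fin (k + 2), q ≠ 0 → (q - 1).val = q.val - 1 := by
          intro q hq
          exact Fin.val_sub_one_of_ne_zero hq
        have hlast : ∀ q : Fin (k + 2), q - 1 = Fin.last (k + 1) → q = 0 := by
          intro q h
          rw [← last_add (k := k), ← h]; simp
        by_cases h0 : 0 ∈ P
        · by_cases h1 : 1 ∈ P
          · apply stepa
            apply hl
            · exact Finset.card_image_le.trans hc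
            · refine Finset.mem_image.2 ⟨0, h0, ?_⟩
              exact sub_eq_of_eq_add (last_add (k := k)).symm
            · exact Finset.mem_image.2 ⟨1, h1, by simp⟩
          · have hQ : Reach k l (insert 0 ((P.erase 0).image (· - 1)), R) := by
              apply ihj
              · refine (Finset.card_insert_le _ _).trans ?_
                have := Finset.card_image_le (s := P.erase 0) (f := (· - 1))
                rw [Finset.card_erase_of_mem h0] at this
                have := Finset.card_pos.2 hne
                omega
              · exact Finset.insert_nonempty _ _
              · intro h
                rcases Finset.mem_insert.1 h with h | h
                · exact last_ne h
                · obtain ⟨q, hq, h⟩ := Finset.mem_image.1 h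
                  simp [hlast q h] at hq
              · intro i hi
                rcases Finset.mem_insert.1 hi with h | h
                · simp [h]
                · obtain ⟨q, hq, rfl⟩ := Finset.mem_image.1 h
                  obtain ⟨hq0, hq⟩ := Finset.mem_erase.1 hq
                  have := hval q hq0
                  have := hb q hq
                  omega
            have := hQ.step 1
            have e : (insert 0 ((P.erase 0).image (· - 1))).image (fA k 1) = P := by
              ext y
              simp only [Finset.mem_image, Finset.mem_insert, fA1, Finset.mem_erase]
              constructor
              · rintro ⟨q, rfl | ⟨p, ⟨hp0, hp⟩, rfl⟩, rfl⟩
                · simpa using h0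
                · have : p - 1 ≠ 0 := by
                    intro h
                    rw [sub_eq_zero] at h
                    exact h1 (h ▸ hp)
                  simpa [this] using hp
              · intro hy
                by_cases hy0 : y = 0
                · exact ⟨0, Or.inl rfl, by simp [hy0]⟩
                · refine ⟨y - 1, Or.inr ⟨y, ⟨hy0, hy⟩, rfl⟩, ?_⟩
                  have : y - 1 ≠ 0 := by
                    intro h
                    rw [sub_eq_zero] at h
                    exact h1 (h ▸ hy)
                  simp [this]
            simp only [stp, imB1, e, if_neg hlP] at this
            exact this
        · apply stepa
          apply ihj
          · exact Finset.card_image_le.trans hc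
          · exact hne.image _
          · intro h
            obtain ⟨q, hq, h⟩ := Finset.mem_image.1 h
            exact h0 (hlast q h ▸ hq)
          · intro i hi
            obtain ⟨q, hq, rfl⟩ := Finset.mem_image.1 hi
            have hq0 : q ≠ 0 := fun h => h0 (h ▸ hq)
            have := hval q hq0
            have := hb q hq
            omega
    intro P hc hne hcl
    by_cases h : Fin.last (k + 1) ∈ P
    · exact hl P hc h (hcl h)
    · exact hn (k + 1) P hc hne h (fun i _ => by have := i.2; omega)

/-- valid states -/
def Valid (s : St k l) : Prop :=
  s.1.Nonempty ∧ s.2.Nonempty ∧ (Fin.last (k + 1) ∈ s.1 → 0 ∈ s.1 ∧ 0 ∈ s.2)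

lemma reach_valid (s : St k l) (h : Valid s) : Reach k l s := by
  obtain ⟨P, R⟩ := s
  obtain ⟨h1, ⟨r, hr⟩, h3⟩ := h
  simp only at *
  by_cases hl : Fin.last (k + 1) ∈ P
  · exact reach_P R (h3 hl).2 _ P le_rfl h1 (fun h => (h3 h).1)
  · have := reach_P (R.image (· + -r)) (Finset.mem_image.2 ⟨r, hr, by simp⟩) _ P le_rfl h1
      (fun h => (h3 h).1)
    have := reach_shift this hl r
    convert this using 2
    ext y
    simp

/-! Distinguishability -/

def Eqv (s t : St k l) : Prop :=
  ∀ w, (dD k l).evalFrom s w ∈ (dD k l).accept ↔ (dD k l).evalFrom t w ∈ (dD k l).accept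

lemma Eqv.symm {s t : St k l} (h : Eqv s t) : Eqv t s := fun w => (h w).symm

lemma Eqv.step {s t : St k l} (h : Eqv s t) (x : Fin 4) : Eqv (stp k l s x) (stp k l t x) :=
  fun w => h (x :: w)

lemma Eqv.nil {s t : St k l} (h : Eqv s t) : Fin.last (l + 1) ∈ s.2 ↔ Fin.last (l + 1) ∈ t.2 :=
  h []

lemma mem_stp1 {s : St k l} {p} (h : p ∈ s.1) (x : Fin 4) : fA k x p ∈ (stp k l s x).1 := by
  have := Finset.mem_image_of_mem (fA k x) h
  unfold stp; split_ifs
  · exact Finset.mem_insert_of_mem this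
  · exact this

lemma mem_stp2 {s : St k l} {p} (h : p ∈ s.2) (x : Fin 4) : fB l x p ∈ (stp k l s x).2 := by
  have := Finset.mem_image_of_mem (fB l x) h
  unfold stp; split_ifs
  · exact Finset.mem_insert_of_mem this
  · exact this

lemma of_mem_stp1 {s : St k l} {p} {x : Fin 4} (h : p ∈ (stp k l s x).1) :
    p = 0 ∨ ∃ q ∈ s.1, fA k x q = p := by
  unfold stp at h; split_ifs at h
  · simpa using h
  · right; simpa using h

lemma dist1 (r : Fin (l + 2)) : ∀ s t : St k l, Fin.last (k + 1) ∉ t.1 → Eqv s t → r ∈ s.2 →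
    r ∈ t.2 := by
  induction r using Fin.reverseInduction with
  | last => intro s t _ h; exact h.nil.1
  | cast i ih =>
    intro s t ht h hr
    have e : stp k l t 2 = (t.1, t.2.image (fB l 2)) := by
      simp only [stp, imA2, if_neg ht]
    have h1 := ih _ _ (by rw [e]; exact ht) (h.step 2)
      (by have := mem_stp2 hr 2; rwa [fB2, Fin.coeSucc_eq_succ] at this)
    rw [e] at h1
    obtain ⟨q, hq, h2⟩ := Finset.mem_image.1 h1
    rw [fB2, ← Fin.coeSucc_eq_succ] at h2
    rwa [← add_right_cancel h2]

lemma dist2 (r : Fin (l + 2)) (N : ℕ) : ∀ s t : St k l, 0 ∈ t.2 →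
    (∀ q ∈ t.1, q = 0 ∨ k + 2 ≤ q.val + N) → Eqv s t → r ∈ s.2 → r ∈ t.2 := by
  induction N with
  | zero =>
    intro s t h0 hq
    apply dist1
    intro h
    rcases hq _ h with h | h
    · exact last_ne h
    · simp at h
  | succ N ih =>
    intro s t h0 hq h hr
    have e : (stp k l t 1).2 = t.2 := by
      simp only [stp, imB1]
      split_ifs
      · exact Finset.insert_eq_of_mem h0
      · rfl
    rw [← e]
    apply ih _ _ (by rwa [e]) _ (h.step 1)
    · have := mem_stp2 hr 1; rwa [fB1] at this
    · intro q hq'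
      rcases of_mem_stp1 hq' with h | ⟨p, hp, rfl⟩
      · exact Or.inl h
      · rw [fA1]
        split_ifs with hp0
        · exact Or.inl rfl
        · by_cases hpl : p = Fin.last (k + 1)
          · left; rw [hpl, last_add]
          · right
            have h1 := (hq p hp).resolve_left hp0
            have : (p + 1).val = p.val + 1 := Fin.val_add_one_of_lt (Fin.lt_last_iff_ne_last.2 hpl)
            omega

lemma dist3 {s t : St k l} (ht : Valid t) (h : Eqv s t) : s.2 ⊆ t.2 := by
  intro r hr
  by_cases hl : Fin.last (k + 1) ∈ t.1
  · exact dist2 r (k + 2) s t (ht.2.2 hl).2 (fun q _ => Or.inr (by omega)) h hr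
  · exact dist1 r s t hl h hr

lemma dist4 (p : Fin (k + 2)) : p ≠ 0 → ∀ s t : St k l, Eqv s t → p ∈ s.1 → p ∈ t.1 := by
  induction p using Fin.reverseInduction with
  | last =>
    intro _ s t h hs
    by_contra ht
    have e : stp k l t 3 = (t.1, t.2.image (fB l 3)) := by
      simp only [stp, imA3, if_neg ht]
    have e2 : stp k l (stp k l t 3) 2 = (t.1, (t.2.image (fB l 3)).image (fB l 2)) := by
      rw [e]; simp only [stp, imA2, if_neg ht]
    have h2 := (h.step 3).step 2
    have h3 : 0 ∈ (stp k l (stp k l s 3) 2).2 := by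
      have := mem_stp1 hs 3
      rw [fA3] at this
      generalize stp k l s 3 = u at *
      simp [stp, imA2, this]
    have h4 := dist1 0 _ _ (by rw [e2]; exact ht) h2 h3
    rw [e2] at h4
    simp [fB2, fB3] at h4
  | cast i ih =>
    intro hi s t h hs
    have h1 := mem_stp1 hs 1
    rw [fA1, if_neg hi, Fin.coeSucc_eq_succ] at h1
    have h2 := ih (Fin.succ_ne_zero i) _ _ (h.step 1) h1
    rcases of_mem_stp1 h2 with h3 | ⟨q, hq, h3⟩
    · exact absurd h3 (Fin.succ_ne_zero i)
    · rw [fA1] at h3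
      split_ifs at h3
      · exact absurd h3.symm (Fin.succ_ne_zero i)
      · rw [← Fin.coeSucc_eq_succ] at h3
        rwa [← add_right_cancel h3]

lemma dist5 {s t : St k l} (h : Eqv s t) : s.1 ⊆ t.1 := by
  intro p hp
  by_cases hp0 : p = 0
  · subst hp0
    have h1 := mem_stp1 hp 0
    rw [fA0, zero_add] at h1
    have h2 := dist4 1 one_ne_zero _ _ (h.step 0) h1
    rcases of_mem_stp1 h2 with h3 | ⟨q, hq, h3⟩
    · exact absurd h3 one_ne_zero
    · rw [fA0] at h3
      have : q = 0 := by simpa using h3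
      rwa [← this]
  · exact dist4 p hp0 s t h hp

lemma dist {s t : St k l} (hs : Valid s) (ht : Valid t) (h : Eqv s t) : s = t :=
  Prod.ext (Finset.Subset.antisymm (dist5 h) (dist5 h.symm))
    (Finset.Subset.antisymm (dist3 ht h) (dist3 hs h.symm))

/-! Counting -/

def V1 (k l : ℕ) : Finset (St k l) :=
  Finset.Ioc ∅ (Finset.univ.erase (Fin.last (k + 1))) ×ˢ Finset.Ioc ∅ Finset.univ
def V2 (k l : ℕ) : Finset (St k l) :=
  Finset.Icc {0, Fin.last (k + 1)} Finset.univ ×ˢ Finset.Icc {0} Finset.univ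

lemma cardV : (V1 k l ∪ V2 k l).card = (2 ^ (k + 1) - 1) * (2 ^ (l + 2) - 1) + 2 ^ k * 2 ^ (l + 1) := by
  rw [Finset.card_union_of_disjoint]
  · rw [V1, V2, Finset.card_product, Finset.card_product, Finset.card_Ioc_finset (by simp),
      Finset.card_Ioc_finset (by simp), Finset.card_Icc_finset (by simp),
      Finset.card_Icc_finset (by simp), Finset.card_erase_of_mem (by simp),
      Finset.card_pair last_ne.symm]
    simp
  · rw [Finset.disjoint_left]
    rintro ⟨P, R⟩ h1 h2
    simp only [V1, V2, Finset.mem_product, Finset.mem_Ioc, Finset.mem_Icc] at h1 h2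
    have h3 := h1.1.2 (h2.1.1 (by simp : Fin.last (k + 1) ∈ _))
    simp at h3

lemma validV (s : St k l) (h : s ∈ V1 k l ∪ V2 k l) : Valid s := by
  obtain ⟨P, R⟩ := s
  rcases Finset.mem_union.1 h with h | h
  · simp only [V1, Finset.mem_product, Finset.mem_Ioc] at h
    refine ⟨Finset.nonempty_iff_ne_empty.2 (ne_of_gt h.1.1),
      Finset.nonempty_iff_ne_empty.2 (ne_of_gt h.2.1), fun hl => ?_⟩
    have h3 := h.1.2 hl
    simp at h3
  · simp only [V2, Finset.mem_product, Finset.mem_Icc] at h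
    have h0 : 0 ∈ P := h.1.1 (by simp)
    have h1 : 0 ∈ R := h.2.1 (by simp)
    exact ⟨⟨_, h0⟩, ⟨_, h1⟩, fun _ => ⟨h0, h1⟩⟩

lemma main (k l : ℕ) (σ : Type) (inst : Fintype σ) (C : DFA (Fin 4) σ)
    (hC : C.accepts = (dA k).accepts∗ * (dB l).accepts) :
    (2 ^ (k + 1) - 1) * (2 ^ (l + 2) - 1) + 2 ^ k * 2 ^ (l + 1) ≤ Fintype.card σ := by
  rw [← accepts_eq] at hC
  have hr : ∀ s : St k l, ∃ w, Valid s → (dD k l).eval w = s := by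
    intro s
    by_cases h : Valid s
    · obtain ⟨w, hw⟩ := reach_valid s h
      exact ⟨w, fun _ => hw⟩
    · exact ⟨[], fun h' => absurd h' h⟩
  choose f hf using hr
  rw [← cardV, ← Finset.card_univ]
  apply Finset.card_le_card_of_injOn (fun s => C.eval (f s)) (fun _ _ => Finset.mem_univ _)
  intro s hs t ht hst
  have hs := validV s hs
  have ht := validV t ht
  apply dist hs ht
  have key : ∀ s, Valid s → ∀ w, (dD k l).evalFrom s w ∈ (dD k l).accept ↔
      C.evalFrom (C.eval (f s)) w ∈ C.accept := by
    intro s hs w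
    have h1 : f s ++ w ∈ (dD k l).accepts ↔ f s ++ w ∈ C.accepts := by rw [hC]
    rw [DFA.mem_accepts, DFA.mem_accepts, DFA.eval, DFA.eval, DFA.evalFrom_of_append,
      DFA.evalFrom_of_append] at h1
    have h2 := hf s hs
    rw [DFA.eval] at h2
    rw [h2] at h1
    exact h1
  intro w
  rw [key s hs, key t ht]
  simp only at hst
  rw [hst]

lemma arith (k l : ℕ) : 5 * 2 ^ (k + 2 + (l + 2) - 3) - 2 ^ (k + 2 - 1) - 2 ^ (l + 2) + 1 ≤
    (2 ^ (k + 1) - 1) * (2 ^ (l + 2) - 1) + 2 ^ k * 2 ^ (l + 1) := by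
  have e1 : k + 2 + (l + 2) - 3 = k + l + 1 := by omega
  have e2 : k + 2 - 1 = k + 1 := by omega
  rw [e1, e2]
  obtain ⟨x, hx⟩ : ∃ x, 2 ^ k = x + 1 := ⟨2 ^ k - 1, by have := Nat.one_le_two_pow (n := k); omega⟩
  obtain ⟨y, hy⟩ : ∃ y, 2 ^ l = y + 1 := ⟨2 ^ l - 1, by have := Nat.one_le_two_pow (n := l); omega⟩
  simp only [pow_add, hx, hy]
  have e3 : (x + 1) * 2 ^ 1 - 1 = 2 * x + 1 := by omega
  have e4 : (y + 1) * 2 ^ 2 - 1 = 4 * y + 3 := by omega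
  rw [e3, e4]
  have : 5 * ((x + 1) * (y + 1) * 2 ^ 1) + 1 = (2 * x + 1) * (4 * y + 3) +
    (x + 1) * ((y + 1) * 2 ^ 1) + (x + 1) * 2 ^ 1 + (y + 1) * 2 ^ 2 := by ring
  have : (2 * x + 1) * (4 * y + 3) ≥ 1 := Nat.succ_le_of_lt (by positivity)
  omega

end StarCat

/-- Lower bound 5·2^(m+n−3) − 2^(m−1) − 2^n + 1 for star combined with catenation is
    reachable by witnesses over a four-letter alphabet. -/
theorem starcat_lower (m n : ℕ) (hm : 2 ≤ m) (hn : 2 ≤ n) :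
    ∃ (A : DFA (Fin 4) (Fin m)) (B : DFA (Fin 4) (Fin n)),
      ∀ (σ : Type) (inst : Fintype σ) (C : DFA (Fin 4) σ),
        C.accepts = (A.accepts)∗ * B.accepts →
        5 * 2 ^ (m + n - 3) - 2 ^ (m - 1) - 2 ^ n + 1 ≤ @Fintype.card σ inst := by
  obtain ⟨k, rfl⟩ := Nat.exists_eq_add_of_le' hm
  obtain ⟨l, rfl⟩ := Nat.exists_eq_add_of_le' hn
  exact ⟨StarCat.dA k, StarCat.dB l, fun σ inst C hC =>
    (StarCat.arith k l).trans (StarCat.main k l σ inst C hC)⟩
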